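/- Let a,b,c,d ≥ 0 satisfy a+c = 2, b+d = 1, bd = (1-a)² (Class I). Then W[a,b,c,d] is block-positive: for all vectors ψ, φ ∈ ℂ⁴ one has ⟨ψ⊗φ| W[a,b,c,d] |ψ⊗φ⟩ ≥ 0. -/

import Mathlib

open Complex Matrix ComplexOrder

/-- The entanglement witness `W[a,b,c,d]` on `ℂ⁴ ⊗ ℂ⁴`, identified with a
`16 × 16` complex matrix in the product basis `|i,j⟩`, indices mod 4. -/
noncomputable def W4 (a b c d : ℝ) :
    Matrix (Fin 4 × Fin 4) (Fin 4 × Fin 4) ℂ := fun p q =>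
  if p = q then
    (if p.2 = p.1 then (a : ℂ)
     else if p.2 = p.1 + 1 then (b : ℂ)
     else if p.2 = p.1 + 2 then (c : ℂ)
     else (d : ℂ))
  else if p.1 = p.2 ∧ q.1 = q.2 then -1 else 0

/-- The product vector `ψ ⊗ φ`. -/
def prodVec {α β : Type*} (ψ : α → ℂ) (φ : β → ℂ) : α × β → ℂ :=
  fun p => ψ p.1 * φ p.2

/-- The pairing `⟨v| X |v⟩`. -/
noncomputable def pairing {n : Type*} [Fintype n] (X : Matrix n n ℂ) (v : n → ℂ) : ℂ :=
  star v ⬝ᵥ X.mulVec v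

/-- The linear form multiplying `|ψ₀|²` in the expectation value of `W[a,b,c,d]`, up to the
rank-one part; the other three are obtained by rotating the arguments. -/
def rowForm (a b c d x y z w : ℝ) : ℝ := (a + 1) * x + b * y + c * z + d * w

/-- The quartic form obtained by clearing denominators in `∑ yᵢ / Fᵢ(y) ≤ 1`. -/
def clearedForm (a b c d x y z w : ℝ) : ℝ :=
  rowForm a b c d x y z w * rowForm a b c d y z w x * rowForm a b c d z w x y
      * rowForm a b c d w x y z
    - x * (rowForm a b c d y z w x * rowForm a b c d z w x y * rowForm a b c d w x y z)
    - y * (rowForm a b c d x y z w * rowForm a b c d z w x y * rowForm a b c d w x y z)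
    - z * (rowForm a b c d x y z w * rowForm a b c d y z w x * rowForm a b c d w x y z)
    - w * (rowForm a b c d x y z w * rowForm a b c d y z w x * rowForm a b c d z w x y)

/-- The cubic form governing `clearedForm` on the face where the last variable vanishes. -/
def faceForm (a b c d x y z : ℝ) : ℝ :=
  (a * x + b * y + c * z) * ((a + 1) * y + b * z + d * x) * ((a + 1) * z + c * x + d * y)
    - y * ((a + 1) * x + b * y + c * z) * ((a + 1) * z + c * x + d * y)
    - z * ((a + 1) * x + b * y + c * z) * ((a + 1) * y + b * z + d * x)

theorem clearedForm_zero_right (a b c d x y z : ℝ) :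
    clearedForm a b c d x y z 0 = (b * x + c * y + d * z) * faceForm a b c d x y z := by
  simp only [clearedForm, faceForm, rowForm]
  ring

theorem clearedForm_rotate (a b c d x y z w : ℝ) :
    clearedForm a b c d x y z w = clearedForm a b c d y z w x := by
  simp only [clearedForm]
  ring

theorem faceForm_eq_sum_sq {a b c d e p q : ℝ} (x y z s t : ℝ) (ha : a = 1 - e) (hc : c = 1 + e)
    (hb : b = p ^ 2) (hd : d = q ^ 2) (he : e = p * q) (h : b + d = 1) :
    faceForm a b c d x y z =
      a * y * (d * x - e * y + b * z) ^ 2 + a * c * (x * (q * x - p * y + s * z) ^ 2)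
        + a * c * (z * (p * z - q * y + t * x) ^ 2)
        + x * z * ((a * b * c + d * (1 + 2 * e ^ 2) - a * c * (2 * s * q + t ^ 2)) * x
          + (a * c * d + b * (1 + 2 * e ^ 2) - a * c * (2 * t * p + s ^ 2)) * z
          + (2 * a * c * (s * p + t * q) - (2 - 2 * e + 4 * e ^ 3)) * y) := by
  have h1 : e ^ 2 = b * d := by subst_vars; ring
  obtain rfl : d = 1 - b := by linarith
  subst ha hc
  unfold faceForm
  grind

theorem face_coeff_le_of_nonneg {b d e : ℝ} (hb : 0 ≤ b) (hd : 0 ≤ d) (h : b + d = 1)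
    (he : e ^ 2 = b * d) :
    (1 - e ^ 2) * (2 * e * b * (1 + 2 * d) + d ^ 3 * (1 + 2 * b) ^ 2)
      ≤ (1 - e ^ 2) * b + d * (1 + 2 * e ^ 2) := by
  have he' : e ≤ b * d + 1 / 4 := by nlinarith [sq_nonneg (e - 1 / 2)]
  have hbd : 0 ≤ 1 - b * d := by nlinarith
  rw [he]
  have hmono : (1 - b * d) * (2 * e * b * (1 + 2 * d) + d ^ 3 * (1 + 2 * b) ^ 2)
      ≤ (1 - b * d) * (2 * (b * d + 1 / 4) * b * (1 + 2 * d) + d ^ 3 * (1 + 2 * b) ^ 2) := by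
    gcongr
  have hpos : 0 ≤ (b - d) ^ 2 * (b ^ 5 / 2 + 3 / 2 * d * b ^ 4 + 2 * d ^ 2 * b ^ 3
      + d ^ 3 * b ^ 2 / 2 + d ^ 4 * b / 2) := by positivity
  obtain rfl : b = 1 - d := by linarith
  linarith

theorem face_coeff_le_of_nonpos {b d e : ℝ} (hb : 0 ≤ b) (hd : 0 ≤ d) (h : b + d = 1)
    (he : e ^ 2 = b * d) (he0 : e ≤ 0) (he1 : -(1 / 2) ≤ e) :
    (1 - e ^ 2) * (2 * (1 - e + e ^ 2) * e + (1 - e + e ^ 2) ^ 2 * d)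
      ≤ (1 - e ^ 2) * b + d * (1 + 2 * e ^ 2) := by
  obtain ⟨f, rfl⟩ : ∃ f, e = -f := ⟨-e, by ring⟩
  have hf : 0 ≤ f := by linarith
  have hf1 : f ≤ 1 / 2 := by linarith
  obtain rfl : b = 1 - d := by linarith
  have hd1 : 0 ≤ 1 - f ^ 2 - d := by nlinarith
  have hff : 0 ≤ 1 - f ^ 2 := by nlinarith
  have hslope : 0 ≤ (1 - f ^ 2) * ((1 + f + f ^ 2) ^ 2 + 1) - 1 - 2 * f ^ 2 := by
    have h0 : 0 ≤ f * (1 - f ^ 2) * (2 + 3 * f + 2 * f ^ 2 + f ^ 3) := by positivity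
    nlinarith
  have hend : 0 ≤ (1 - f ^ 2) * (3 * f ^ 2 + 2 * f ^ 3 + 2 * f ^ 4 + 2 * f ^ 5 + f ^ 6) := by
    positivity
  nlinarith [mul_nonneg hd1 hslope]

theorem faceForm_nonneg {a b c d e x y z : ℝ} (ha : a = 1 - e) (hc : c = 1 + e) (hb : 0 ≤ b)
    (hd : 0 ≤ d) (h : b + d = 1) (he : e ^ 2 = b * d) (hx : 0 ≤ x) (hy : 0 ≤ y) (hz : 0 ≤ z) :
    0 ≤ faceForm a b c d x y z := by
  have he2 : e ^ 2 ≤ (1 / 2) ^ 2 := by nlinarith [sq_nonneg (b - d)]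
  obtain ⟨hel, heu⟩ := abs_le_of_sq_le_sq' he2 (by norm_num)
  have ha0 : 0 ≤ a := by linarith
  have hc0 : 0 ≤ c := by linarith
  have hac : a * c = 1 - e ^ 2 := by subst ha hc; ring
  suffices H : ∃ p q s t : ℝ, b = p ^ 2 ∧ d = q ^ 2 ∧ e = p * q ∧
      (1 - e ^ 2) * (2 * s * q + t ^ 2) ≤ (1 - e ^ 2) * b + d * (1 + 2 * e ^ 2) ∧
      (1 - e ^ 2) * (2 * t * p + s ^ 2) ≤ (1 - e ^ 2) * d + b * (1 + 2 * e ^ 2) ∧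
      2 - 2 * e + 4 * e ^ 3 ≤ 2 * (1 - e ^ 2) * (s * p + t * q) by
    obtain ⟨p, q, s, t, hp, hq, hpq, h1, h2, h3⟩ := H
    rw [faceForm_eq_sum_sq x y z s t ha hc hp hq hpq h]
    have k1 : 0 ≤ a * b * c + d * (1 + 2 * e ^ 2) - a * c * (2 * s * q + t ^ 2) := by
      rw [mul_right_comm, hac]; linarith
    have k2 : 0 ≤ a * c * d + b * (1 + 2 * e ^ 2) - a * c * (2 * t * p + s ^ 2) := by
      rw [hac]; linarith
    have k3 : 0 ≤ 2 * a * c * (s * p + t * q) - (2 - 2 * e + 4 * e ^ 3) := by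
      rw [mul_assoc 2 a c, hac]; linarith
    positivity
  have hsb := Real.sq_sqrt hb
  have hsd := Real.sq_sqrt hd
  have hprod : (√b * √d) ^ 2 = e ^ 2 := by rw [mul_pow, hsb, hsd, he]
  rcases le_total 0 e with he0 | he0
  · have hpq : e = √b * √d := ((sq_eq_sq₀ (by positivity) he0).1 hprod).symm
    refine ⟨√b, √d, √b * (b * (1 + 2 * d)), √d * (d * (1 + 2 * b)), hsb.symm, hsd.symm, hpq,
      ?_, ?_, ?_⟩
    · convert face_coeff_le_of_nonneg hb hd h he using 2
      rw [mul_pow, hsd, hpq]; ring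
    · convert face_coeff_le_of_nonneg hd hb (by linarith) (he.trans (mul_comm _ _)) using 2
      rw [mul_pow, hsb, hpq]; ring
    · have hproj : √b * (b * (1 + 2 * d)) * √b + √d * (d * (1 + 2 * b)) * √d = 1 := by
        calc _ = (√b) ^ 2 * b * (1 + 2 * d) + (√d) ^ 2 * d * (1 + 2 * b) := by ring
          _ = (b + d) ^ 2 + 2 * b * d * (b + d - 1) := by rw [hsb, hsd]; ring
          _ = 1 := by rw [h]; ring
      rw [hproj]
      have : 0 ≤ e * (1 - 2 * e) * (1 + e) := by
        have : 0 ≤ 1 - 2 * e := by linarith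
        positivity
      linarith
  · have hpq : e = √b * -√d := by
      have : -e = √b * √d := ((sq_eq_sq₀ (by positivity) (by linarith)).1
        (hprod.trans (neg_sq e).symm)).symm
      linarith
    refine ⟨√b, -√d, √b * (1 - e + e ^ 2), -√d * (1 - e + e ^ 2), hsb.symm,
      by rw [neg_sq, hsd], hpq, ?_, ?_, ?_⟩
    · convert face_coeff_le_of_nonpos hb hd h he he0 hel using 2
      rw [mul_pow, neg_sq, hsd]
      linear_combination -2 * (1 - e + e ^ 2) * hpq
    · convert face_coeff_le_of_nonpos hd hb (by linarith) (he.trans (mul_comm _ _)) he0 hel using 2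
      rw [mul_pow, hsb]
      linear_combination -2 * (1 - e + e ^ 2) * hpq
    · have hproj : √b * (1 - e + e ^ 2) * √b + -√d * (1 - e + e ^ 2) * -√d = 1 - e + e ^ 2 := by
        calc _ = ((√b) ^ 2 + (√d) ^ 2) * (1 - e + e ^ 2) := by ring
          _ = 1 - e + e ^ 2 := by rw [hsb, hsd, h, one_mul]
      rw [hproj]
      have : 0 ≤ (-e) ^ 3 * (1 + e) := by
        have : 0 ≤ -e := by linarith
        have : 0 ≤ 1 + e := by linarith
        positivity
      linarith

theorem clearedForm_add_sub {a b c d e r u v M K N : ℝ} (x y z w t : ℝ) (ha : a = 1 - e)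
    (hc : c = 1 + e) (h : b + d = 1) (he : e ^ 2 = b * d)
    (hr : r = (x + z - y - w) / 2) (hu : u = x - z) (hv : v = y - w)
    (hM : M = -(2 * e * u * v + (b - d) * (u ^ 2 - v ^ 2) / 2))
    (hK : K = (b - d) * u * v - e * (u ^ 2 - v ^ 2)) (hN : N = (u ^ 2 + v ^ 2) / 2) :
    clearedForm a b c d (x + t) (y + t) (z + t) (w + t) - clearedForm a b c d x y z w =
      2 * t * ((x + y + z + w + 2 * t) * (4 * r ^ 2 + 2 * (1 - 2 * e) * N)
        + r * (4 * (b - d) * M - 3 * (1 - 2 * e) * K)) := by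
  obtain rfl : d = 1 - b := by linarith
  subst ha hc
  simp only [clearedForm, rowForm]
  subst_vars
  ring_nf at he ⊢
  grind

theorem clearedForm_le_add {a b c d e x y z w t : ℝ} (ha : a = 1 - e) (hc : c = 1 + e)
    (h : b + d = 1) (he : e ^ 2 = b * d) (hx : 0 ≤ x) (hy : 0 ≤ y) (hz : 0 ≤ z) (hw : 0 ≤ w)
    (ht : 0 ≤ t) :
    clearedForm a b c d x y z w ≤ clearedForm a b c d (x + t) (y + t) (z + t) (w + t) := by
  rw [← sub_nonneg, clearedForm_add_sub x y z w t ha hc h he rfl rfl rfl rfl rfl rfl]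
  have he2 : e ^ 2 ≤ (1 / 2) ^ 2 := by nlinarith [sq_nonneg (b - d)]
  obtain ⟨-, heu⟩ := abs_le_of_sq_le_sq' he2 (by norm_num)
  have hS : (b - d) ^ 2 = 1 - 4 * e ^ 2 := by
    linear_combination (b + d + 1) * h + 4 * he
  set r := (x + z - y - w) / 2
  set u := x - z with hu
  set v := y - w with hv
  set M := -(2 * e * u * v + (b - d) * (u ^ 2 - v ^ 2) / 2) with hM
  set K := (b - d) * u * v - e * (u ^ 2 - v ^ 2) with hK
  set N := (u ^ 2 + v ^ 2) / 2 with hN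
  set H := x + y + z + w with hH
  have hN0 : 0 ≤ N := by positivity
  have hH0 : 0 ≤ H := by positivity
  have hε : 0 ≤ 1 - 2 * e := by linarith
  have hMK : M ^ 2 + K ^ 2 = N ^ 2 := by
    rw [hM, hK, hN]
    linear_combination (u ^ 2 * v ^ 2 + (u ^ 2 - v ^ 2) ^ 2 / 4) * hS
  have hNH : N ≤ H ^ 2 := by
    have h1 : u ^ 2 ≤ H ^ 2 := sq_le_sq' (by linarith) (by linarith)
    have h2 : v ^ 2 ≤ H ^ 2 := sq_le_sq' (by linarith) (by linarith)
    linarith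
  set ε := 1 - 2 * e with hε'
  have hS' : (b - d) ^ 2 = ε * (2 - ε) := by rw [hS, hε']; ring
  clear_value r u v M K N H ε
  have hcs : (4 * (b - d) * M - 3 * ε * K) ^ 2 ≤ 32 * ε * N ^ 2 := by
    have h1 : (4 * (b - d) * M - 3 * ε * K) ^ 2 + (4 * (b - d) * K + 3 * ε * M) ^ 2
        = (32 * ε - 7 * ε ^ 2) * N ^ 2 := by
      linear_combination (16 * (b - d) ^ 2 + 9 * ε ^ 2) * hMK + 16 * N ^ 2 * hS'
    nlinarith [sq_nonneg (4 * (b - d) * K + 3 * ε * M), mul_nonneg (sq_nonneg ε) (sq_nonneg N)]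
  have hkey : (r * (4 * (b - d) * M - 3 * ε * K)) ^ 2 ≤ (H * (4 * r ^ 2 + 2 * ε * N)) ^ 2 := by
    calc (r * (4 * (b - d) * M - 3 * ε * K)) ^ 2
        = r ^ 2 * (4 * (b - d) * M - 3 * ε * K) ^ 2 := mul_pow _ _ _
      _ ≤ r ^ 2 * (32 * ε * N ^ 2) := by gcongr
      _ = 32 * r ^ 2 * ε * N * N := by ring
      _ ≤ 32 * r ^ 2 * ε * N * H ^ 2 := by gcongr
      _ ≤ (H * (4 * r ^ 2 + 2 * ε * N)) ^ 2 := by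
        linarith [sq_nonneg (H * (4 * r ^ 2 - 2 * ε * N))]
  have habs := abs_le_of_sq_le_sq' hkey (by positivity)
  have hmore : 0 ≤ 2 * t * (4 * r ^ 2 + 2 * ε * N) := by positivity
  have : 0 ≤ (H + 2 * t) * (4 * r ^ 2 + 2 * ε * N) + r * (4 * (b - d) * M - 3 * ε * K) := by
    linarith [habs.1]
  positivity

theorem clearedForm_nonneg_of_last_le {a b c d e x y z w : ℝ} (ha : a = 1 - e) (hc : c = 1 + e)
    (hb : 0 ≤ b) (hd : 0 ≤ d) (h : b + d = 1) (he : e ^ 2 = b * d) (hw : 0 ≤ w) (hx : w ≤ x)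
    (hy : w ≤ y) (hz : w ≤ z) : 0 ≤ clearedForm a b c d x y z w := by
  have hx' := sub_nonneg.2 hx
  have hy' := sub_nonneg.2 hy
  have hz' := sub_nonneg.2 hz
  have hmono := clearedForm_le_add ha hc h he hx' hy' hz' le_rfl hw
  have hface := faceForm_nonneg ha hc hb hd h he hx' hy' hz'
  have he2 : e ^ 2 ≤ 1 ^ 2 := by nlinarith
  have hc0 : 0 ≤ c := by linarith [(abs_le_of_sq_le_sq' he2 zero_le_one).1]
  rw [clearedForm_zero_right] at hmono
  simp only [sub_add_cancel, zero_add] at hmono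
  exact le_trans (by positivity) hmono

theorem clearedForm_nonneg {a b c d e x y z w : ℝ} (ha : a = 1 - e) (hc : c = 1 + e)
    (hb : 0 ≤ b) (hd : 0 ≤ d) (h : b + d = 1) (he : e ^ 2 = b * d) (hx : 0 ≤ x) (hy : 0 ≤ y)
    (hz : 0 ≤ z) (hw : 0 ≤ w) : 0 ≤ clearedForm a b c d x y z w := by
  have key {x y z w : ℝ} := clearedForm_nonneg_of_last_le (x := x) (y := y) (z := z) (w := w)
    ha hc hb hd h he
  rcases le_total x y with hxy | hxy <;> rcases le_total z w with hzw | hzw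
  · rcases le_total x z with hxz | hxz
    · rw [clearedForm_rotate]
      exact key hx hxy hxz (hxz.trans hzw)
    · rw [← clearedForm_rotate]
      exact key hz hzw hxz (hxz.trans hxy)
  · rcases le_total x w with hxw | hxw
    · rw [clearedForm_rotate]
      exact key hx hxy (hxw.trans hzw) hxw
    · exact key hw hxw (hxw.trans hxy) hzw
  · rcases le_total y z with hyz | hyz
    · rw [clearedForm_rotate, clearedForm_rotate]
      exact key hy hyz (hyz.trans hzw) hxy
    · rw [← clearedForm_rotate]
      exact key hz hzw (hyz.trans hxy) hyz
  · rcases le_total y w with hyw | hyw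
    · rw [clearedForm_rotate, clearedForm_rotate]
      exact key hy (hyw.trans hzw) hyw hxy
    · exact key hw (hyw.trans hxy) hyw hzw

/-- The coefficient of `|ψ i|²` in the diagonal part of the expectation value, as a function of
`y j = |φ j|²`. -/
def cyclicForm (a b c d : ℝ) (y : Fin 4 → ℝ) (i : Fin 4) : ℝ :=
  rowForm a b c d (y i) (y (i + 1)) (y (i + 2)) (y (i + 3))

theorem sum_div_cyclicForm_le_one {a b c d e : ℝ} (ha : a = 1 - e) (hc : c = 1 + e) (hb : 0 ≤ b)
    (hd : 0 ≤ d) (h : b + d = 1) (he : e ^ 2 = b * d) {y : Fin 4 → ℝ} (hy : ∀ i, 0 ≤ y i)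
    (hpos : ∀ i, 0 < cyclicForm a b c d y i) : ∑ i, y i / cyclicForm a b c d y i ≤ 1 := by
  have hG := clearedForm_nonneg ha hc hb hd h he (hy 0) (hy 1) (hy 2) (hy 3)
  have h0 : 0 < rowForm a b c d (y 0) (y 1) (y 2) (y 3) := hpos 0
  have h1 : 0 < rowForm a b c d (y 1) (y 2) (y 3) (y 0) := hpos 1
  have h2 : 0 < rowForm a b c d (y 2) (y 3) (y 0) (y 1) := hpos 2
  have h3 : 0 < rowForm a b c d (y 3) (y 0) (y 1) (y 2) := hpos 3
  unfold clearedForm at hG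
  rw [Fin.sum_univ_four]
  change y 0 / rowForm a b c d (y 0) (y 1) (y 2) (y 3) +
    y 1 / rowForm a b c d (y 1) (y 2) (y 3) (y 0) + y 2 / rowForm a b c d (y 2) (y 3) (y 0) (y 1) +
    y 3 / rowForm a b c d (y 3) (y 0) (y 1) (y 2) ≤ 1
  generalize rowForm a b c d (y 0) (y 1) (y 2) (y 3) = F₀ at *
  generalize rowForm a b c d (y 1) (y 2) (y 3) (y 0) = F₁ at *
  generalize rowForm a b c d (y 2) (y 3) (y 0) (y 1) = F₂ at *
  generalize rowForm a b c d (y 3) (y 0) (y 1) (y 2) = F₃ at *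
  rw [div_add_div _ _ h0.ne' h1.ne', div_add_div _ _ (by positivity) h2.ne',
    div_add_div _ _ (by positivity) h3.ne', div_le_one (by positivity)]
  linarith

theorem sq_sum_mul_le_of_pos {a b c d e : ℝ} (ha : a = 1 - e) (hc : c = 1 + e) (hb : 0 ≤ b)
    (hd : 0 ≤ d) (h : b + d = 1) (he : e ^ 2 = b * d) {s t : Fin 4 → ℝ} (ht : ∀ i, 0 < t i) :
    (∑ i, s i * t i) ^ 2 ≤ ∑ i, s i ^ 2 * cyclicForm a b c d (fun j => t j ^ 2) i := by
  have he2 : e ^ 2 ≤ (1 / 2) ^ 2 := by nlinarith [sq_nonneg (b - d)]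
  obtain ⟨hel, heu⟩ := abs_le_of_sq_le_sq' he2 (by norm_num)
  have ha0 : 0 ≤ a := by linarith
  have hc0 : 0 ≤ c := by linarith
  have hpos (i : Fin 4) : 0 < cyclicForm a b c d (fun j => t j ^ 2) i := by
    have := ht i
    unfold cyclicForm rowForm
    positivity
  have hsum := sum_div_cyclicForm_le_one ha hc hb hd h he (fun i => sq_nonneg (t i)) hpos
  have hnn : 0 ≤ ∑ i, s i ^ 2 * cyclicForm a b c d (fun j => t j ^ 2) i :=
    Finset.sum_nonneg fun i _ => mul_nonneg (sq_nonneg _) (hpos i).le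
  refine (Finset.sum_sq_le_sum_mul_sum_of_sq_le_mul Finset.univ
    (f := fun i => s i ^ 2 * cyclicForm a b c d (fun j => t j ^ 2) i)
    (g := fun i => t i ^ 2 / cyclicForm a b c d (fun j => t j ^ 2) i)
    (fun i _ => mul_nonneg (sq_nonneg _) (hpos i).le)
    (fun i _ => div_nonneg (sq_nonneg _) (hpos i).le) fun i _ => ?_).trans
    (mul_le_of_le_one_right hnn hsum)
  have := (hpos i).ne'
  exact le_of_eq (by field_simp)

theorem sq_sum_mul_le {a b c d e : ℝ} (ha : a = 1 - e) (hc : c = 1 + e) (hb : 0 ≤ b)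
    (hd : 0 ≤ d) (h : b + d = 1) (he : e ^ 2 = b * d) {s t : Fin 4 → ℝ} (ht : ∀ i, 0 ≤ t i) :
    (∑ i, s i * t i) ^ 2 ≤ ∑ i, s i ^ 2 * cyclicForm a b c d (fun j => t j ^ 2) i := by
  have hl : Continuous fun δ : ℝ => (∑ i, s i * (t i + δ)) ^ 2 := by fun_prop
  have hr : Continuous fun δ : ℝ =>
      ∑ i, s i ^ 2 * cyclicForm a b c d (fun j => (t j + δ) ^ 2) i := by
    unfold cyclicForm rowForm
    fun_prop
  have hmem : (0 : ℝ) ∈ closure (Set.Ioi 0) := by simp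
  have hle := closure_minimal (s := Set.Ioi (0 : ℝ))
    (t := {δ : ℝ | (∑ i, s i * (t i + δ)) ^ 2 ≤
      ∑ i, s i ^ 2 * cyclicForm a b c d (fun j => (t j + δ) ^ 2) i})
    (fun δ hδ => sq_sum_mul_le_of_pos ha hc hb hd h he fun i => add_pos_of_nonneg_of_pos (ht i) hδ)
    (isClosed_le hl hr) hmem
  simpa using hle

theorem W4_mulVec (a b c d : ℝ) (v : Fin 4 × Fin 4 → ℂ) (i j : Fin 4) :
    (W4 a b c d).mulVec v (i, j) =
      (if j = i then (a + 1 : ℂ) else if j = i + 1 then (b : ℂ) else if j = i + 2 then (c : ℂ)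
        else (d : ℂ)) * v (i, j) - if j = i then ∑ k, v (k, k) else 0 := by
  fin_cases i <;> fin_cases j <;>
    simp [Matrix.mulVec, dotProduct, Fintype.sum_prod_type, Fin.sum_univ_four, W4] <;> ring

theorem pairing_W4_prodVec (a b c d : ℝ) (ψ φ : Fin 4 → ℂ) :
    pairing (W4 a b c d) (prodVec ψ φ) =
      ((∑ i, ‖ψ i‖ ^ 2 * cyclicForm a b c d (fun j => ‖φ j‖ ^ 2) i - ‖∑ i, ψ i * φ i‖ ^ 2 : ℝ) :
        ℂ) := by
  push_cast
  simp only [cyclicForm, rowForm]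
  push_cast
  simp only [← Complex.conj_mul', pairing, dotProduct, Fintype.sum_prod_type, W4_mulVec]
  simp [Fin.sum_univ_four, prodVec]
  ring

/-- for Class I parameters, `W[a,b,c,d]` is block-positive. -/
theorem W4_classI_blockPositive (a b c d : ℝ)
    (ha : 0 ≤ a) (hb : 0 ≤ b) (hc : 0 ≤ c) (hd : 0 ≤ d)
    (h1 : a + c = 2) (h2 : b + d = 1) (h3 : b * d = (1 - a) ^ 2) :
    ∀ ψ φ : Fin 4 → ℂ, 0 ≤ pairing (W4 a b c d) (prodVec ψ φ) := by
  intro ψ φ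
  rw [pairing_W4_prodVec, Complex.zero_le_real, sub_nonneg]
  refine le_trans ?_ (sq_sum_mul_le (e := 1 - a) (s := fun i => ‖ψ i‖) (t := fun i => ‖φ i‖)
    (by ring) (by linarith) hb hd h2 h3.symm fun i => norm_nonneg _)
  gcongr
  exact (norm_sum_le _ _).trans_eq (by simp)
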